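/- Let A be a negative definite symmetric 2×2 real matrix. Then there is no function u ∈ C^∞(ℝ²) solving −Δu = (1 + (Ax,x)) e^{2u} on ℝ² such that u ≤ C for some constant C, ∫_{ℝ²} e^{2u} dx < ∞, and ∫_{ℝ²} |1 + (Ax,x)| e^{2u} dx < ∞. -/

import Mathlib

open MeasureTheory Metric Real Matrix

/-- The Euclidean Laplacian of `u : ℝⁿ → ℝ` at `x`. -/
noncomputable def lap {n : ℕ} (u : EuclideanSpace ℝ (Fin n) → ℝ)
    (x : EuclideanSpace ℝ (Fin n)) : ℝ :=
  ∑ i : Fin n, iteratedFDeriv ℝ 2 u x (fun _ => EuclideanSpace.single i 1)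

section

open Set Filter Topology Complex
open scoped ContDiff ComplexConjugate

/-- The unit vector of angle `θ` in `ℂ`. -/
noncomputable def unitVec (θ : ℝ) : ℂ := Complex.exp (θ * I)

lemma continuous_unitVec : Continuous unitVec := by
  unfold unitVec; fun_prop

@[simp] lemma norm_unitVec (θ : ℝ) : ‖unitVec θ‖ = 1 := by
  simp [unitVec, Complex.norm_exp_ofReal_mul_I]

lemma unitVec_ne_zero (θ : ℝ) : unitVec θ ≠ 0 := Complex.exp_ne_zero _

@[simp] lemma unitVec_pi : unitVec π = unitVec (-π) := by
  simp [unitVec, Complex.exp_neg]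

lemma hasDerivAt_unitVec (θ : ℝ) : HasDerivAt unitVec (I * unitVec θ) θ := by
  have h : HasDerivAt (fun t : ℝ => (t : ℂ) * I) (1 * I) θ :=
    (Complex.ofRealCLM.hasDerivAt (x := θ)).mul_const I
  have h2 := h.cexp
  rw [one_mul, mul_comm] at h2
  exact h2

lemma polarCoord_symm_eq_unitVec (p : ℝ × ℝ) :
    Complex.polarCoord.symm p = p.1 * unitVec p.2 := by
  simp [unitVec, Complex.exp_mul_I]

section Polar

variable {E : Type*} [NormedAddCommGroup E] [NormedSpace ℝ E]

lemma integrableOn_polar {h : ℂ → E} (hm : StronglyMeasurable h) (hi : Integrable h) :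
    IntegrableOn (fun p : ℝ × ℝ => p.1 • h (p.1 * unitVec p.2)) (Ioi 0 ×ˢ Ioo (-π) π) := by
  have hc : Continuous fun p : ℝ × ℝ => (p.1 : ℂ) * unitVec p.2 := by
    have := continuous_unitVec
    fun_prop
  refine ⟨(continuous_fst.stronglyMeasurable.smul
    (hm.comp_measurable hc.measurable)).aestronglyMeasurable, ?_⟩
  have h1 := Complex.lintegral_comp_polarCoord_symm (fun z => ‖h z‖ₑ)
  have h2 := hi.2
  rw [hasFiniteIntegral_iff_enorm] at h2 ⊢
  rw [← h1] at h2
  refine lt_of_le_of_lt (le_of_eq ?_) h2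
  refine setLIntegral_congr_fun (measurableSet_Ioi.prod measurableSet_Ioo) ?_
  rintro ⟨r, θ⟩ hp
  have hr : (0 : ℝ) < r := hp.1
  simp only [polarCoord_symm_eq_unitVec, enorm_smul, smul_eq_mul]
  rw [Real.enorm_of_nonneg hr.le]

lemma integral_polar {h : ℂ → E} (hm : StronglyMeasurable h) (hi : Integrable h) :
    IntegrableOn (fun r : ℝ => ∫ θ in (-π)..π, r • h (r * unitVec θ)) (Ioi 0) ∧
    ∫ r in Ioi (0 : ℝ), ∫ θ in (-π)..π, r • h (r * unitVec θ) = ∫ z, h z := by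
  have h1 := integrableOn_polar hm hi
  have e : ∀ r : ℝ, ∫ θ in (-π)..π, r • h (r * unitVec θ)
      = ∫ θ in Ioo (-π) π, r • h (r * unitVec θ) := fun r => by
    rw [intervalIntegral.integral_of_le (by linarith [pi_pos]), integral_Ioc_eq_integral_Ioo]
  simp_rw [e]
  constructor
  · rw [IntegrableOn, Measure.volume_eq_prod, ← Measure.prod_restrict] at h1
    exact h1.integral_prod_left
  · rw [← Complex.integral_comp_polarCoord_symm]
    simp_rw [polarCoord_symm_eq_unitVec]
    exact (setIntegral_prod _ h1).symm

end Polar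

lemma hasDerivAt_ray {E : Type*} [NormedAddCommGroup E] [NormedSpace ℝ E] {g : ℂ → E}
    (hg : Differentiable ℝ g) (r θ : ℝ) :
    HasDerivAt (fun s : ℝ => g (s * unitVec θ)) (fderiv ℝ g (r * unitVec θ) (unitVec θ)) r := by
  have h : HasDerivAt (fun s : ℝ => (s : ℂ) * unitVec θ) (1 * unitVec θ) r :=
    (Complex.ofRealCLM.hasDerivAt (x := r)).mul_const _
  rw [one_mul] at h
  exact (hg (r * unitVec θ)).hasFDerivAt.comp_hasDerivAt r h

lemma hasDerivAt_circle {E : Type*} [NormedAddCommGroup E] [NormedSpace ℝ E] {g : ℂ → E}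
    (hg : Differentiable ℝ g) (r θ : ℝ) :
    HasDerivAt (fun t : ℝ => g (r * unitVec t))
      (fderiv ℝ g (r * unitVec θ) (I * (r * unitVec θ))) θ := by
  have h := (hasDerivAt_unitVec θ).const_mul (r : ℂ)
  have := (hg (r * unitVec θ)).hasFDerivAt.comp_hasDerivAt θ h
  rwa [mul_left_comm] at this

/-- Integrals of an angular derivative over a circle vanish. -/
lemma integral_circle_fderiv {E : Type*} [NormedAddCommGroup E] [NormedSpace ℝ E]
    [CompleteSpace E] {g : ℂ → E} (hg : ContDiff ℝ 1 g) (r : ℝ) :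
    ∫ θ in (-π)..π, fderiv ℝ g (r * unitVec θ) (I * (r * unitVec θ)) = 0 := by
  have hc := continuous_unitVec
  have hc' := hg.continuous_fderiv one_ne_zero
  rw [intervalIntegral.integral_eq_sub_of_hasDerivAt
    (fun θ _ => hasDerivAt_circle (hg.differentiable one_ne_zero) r θ)]
  · simp
  · apply Continuous.intervalIntegrable
    fun_prop

lemma hasDerivAt_integral_circle {g : ℂ → ℝ} (hg : ContDiff ℝ 1 g) (r : ℝ) :
    HasDerivAt (fun s : ℝ => ∫ θ in (-π)..π, g (s * unitVec θ))
      (∫ θ in (-π)..π, fderiv ℝ g (r * unitVec θ) (unitVec θ)) r := by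
  have hc := continuous_unitVec
  have hc' := hg.continuous_fderiv one_ne_zero
  have hc'' := hg.continuous
  have hF : Continuous fun p : ℝ × ℝ => fderiv ℝ g (p.1 * unitVec p.2) (unitVec p.2) := by
    fun_prop
  obtain ⟨B, hB⟩ := ((isCompact_Icc (a := r - 1) (b := r + 1)).prod
    (isCompact_Icc (a := -π) (b := π))).exists_bound_of_continuousOn hF.continuousOn
  refine (intervalIntegral.hasDerivAt_integral_of_dominated_loc_of_deriv_le
    (F := fun (s : ℝ) θ => g (s * unitVec θ))
    (F' := fun (s : ℝ) θ => fderiv ℝ g (s * unitVec θ) (unitVec θ))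
    (bound := fun _ => B)
    (Icc_mem_nhds (show r - 1 < r by linarith) (show r < r + 1 by linarith))
    (Eventually.of_forall fun s => ?_) ?_ ?_ ?_ ?_ ?_).2
  · exact Continuous.aestronglyMeasurable (by fun_prop)
  · exact Continuous.intervalIntegrable (by fun_prop) _ _
  · exact Continuous.aestronglyMeasurable (by fun_prop)
  · refine Eventually.of_forall fun t ht s hs => hB (s, t) ⟨hs, ?_⟩
    rw [uIoc_of_le (by linarith [pi_pos])] at ht
    exact ⟨ht.1.le, ht.2⟩
  · exact intervalIntegrable_const
  · exact Eventually.of_forall fun t _ s _ => hasDerivAt_ray (hg.differentiable one_ne_zero) s t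

/-- Twice the Wirtinger derivative `∂/∂z̄`. -/
noncomputable def dbar (g : ℂ → ℂ) (z : ℂ) : ℂ := fderiv ℝ g z 1 + I * fderiv ℝ g z I

lemma fderiv_real_apply {E : Type*} [NormedAddCommGroup E] [NormedSpace ℝ E] (L : ℂ →L[ℝ] E)
    (v : ℂ) : L v = v.re • L 1 + v.im • L I := by
  conv_lhs => rw [← Complex.re_add_im v]
  have h1 : (v.re : ℂ) = v.re • (1 : ℂ) := by simp
  have h2 : (v.im : ℂ) * I = v.im • I := by simp
  rw [map_add, h1, h2, map_smul, map_smul]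

lemma dbar_polar (g : ℂ → ℂ) (z v : ℂ) :
    conj v * dbar g z = fderiv ℝ g z v + I * fderiv ℝ g z (I * v) := by
  rw [fderiv_real_apply _ v, fderiv_real_apply _ (I * v), dbar]
  have hv : conj v = v.re - v.im * I := by
    apply Complex.ext <;> simp
  rw [hv]
  simp only [Complex.real_smul, Complex.I_mul_re, Complex.I_mul_im, Complex.ofReal_neg]
  ring_nf
  simp only [Complex.I_sq]
  ring

lemma continuous_dbar {g : ℂ → ℂ} (hg : ContDiff ℝ 1 g) : Continuous (dbar g) := by
  have := hg.continuous_fderiv one_ne_zero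
  unfold dbar
  fun_prop

/-- The Cauchy–Pompeiu formula for compactly supported functions, at the origin. -/
lemma integral_dbar_div {g : ℂ → ℂ} (hg : ContDiff ℝ 1 g) (hs : HasCompactSupport g) :
    ∫ w, dbar g w / w = -(2 * π) * g 0 := by
  have hc := continuous_unitVec
  have hc' := hg.continuous_fderiv one_ne_zero
  have hd := hg.differentiable one_ne_zero
  obtain ⟨ρ, hρ⟩ := hs.isCompact.isBounded.subset_closedBall 0
  have hz : ∀ w : ℂ, ρ < ‖w‖ → fderiv ℝ g w = 0 := fun w hw => by
    by_contra h
    have := hρ (support_fderiv_subset ℝ (f := g) h)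
    rw [mem_closedBall_zero_iff] at this
    linarith
  set A : ℝ × ℝ → ℂ := fun p => fderiv ℝ g (p.1 * unitVec p.2) (unitVec p.2) with hA
  set B : ℝ × ℝ → ℂ := fun p => fderiv ℝ g (p.1 * unitVec p.2) (I * unitVec p.2) with hB
  have hAc : Continuous A := by fun_prop
  have hBc : Continuous B := by fun_prop
  have hint : ∀ F : ℝ × ℝ → ℂ, Continuous F → (∀ p : ℝ × ℝ, ρ < |p.1| → F p = 0) →
      IntegrableOn F (Ioi 0 ×ˢ Ioo (-π) π) := by
    intro F hF h0
    have h1 : IntegrableOn F (Icc 0 ρ ×ˢ Icc (-π) π) :=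
      hF.continuousOn.integrableOn_compact (isCompact_Icc.prod isCompact_Icc)
    refine h1.of_forall_sdiff_eq_zero (measurableSet_Ioi.prod measurableSet_Ioo) ?_
    rintro ⟨r, θ⟩ ⟨⟨h2, h3⟩, h4⟩
    have h2' : 0 < r := h2
    refine h0 _ ?_
    by_contra h
    rw [abs_of_pos h2', not_lt] at h
    exact h4 ⟨⟨h2'.le, h⟩, h3.1.le, h3.2.le⟩
  have hAi : IntegrableOn A (Ioi 0 ×ˢ Ioo (-π) π) := hint A hAc fun p hp => by
    simp [hA, hz (p.1 * unitVec p.2) (by simpa using hp)]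
  have hBi : IntegrableOn B (Ioi 0 ×ˢ Ioo (-π) π) := hint B hBc fun p hp => by
    simp [hB, hz (p.1 * unitVec p.2) (by simpa using hp)]
  rw [← Complex.integral_comp_polarCoord_symm]
  simp_rw [polarCoord_symm_eq_unitVec]
  have e1 : ∫ p in polarCoord.target, p.1 • (dbar g (p.1 * unitVec p.2) / (p.1 * unitVec p.2))
      = ∫ p in Ioi (0 : ℝ) ×ˢ Ioo (-π) π, (A p + I * B p) := by
    refine setIntegral_congr_fun (measurableSet_Ioi.prod measurableSet_Ioo) ?_
    rintro ⟨r, θ⟩ hp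
    have hr : (0 : ℝ) < r := hp.1
    have hr' : (r : ℂ) ≠ 0 := by exact_mod_cast hr.ne'
    simp only [hA, hB, ← dbar_polar]
    have : conj (unitVec θ) = (unitVec θ)⁻¹ := by
      rw [Complex.inv_def, Complex.normSq_eq_norm_sq]; simp
    rw [this, Complex.real_smul]
    have := unitVec_ne_zero θ
    field_simp
  have eA : ∫ p in Ioi (0 : ℝ) ×ˢ Ioo (-π) π, A p = -(2 * π) * g 0 := by
    rw [Measure.volume_eq_prod, ← setIntegral_prod_swap, setIntegral_prod _ (by
      exact hAi.swap)]
    have : ∀ θ : ℝ, ∫ r in Ioi (0 : ℝ), A (r, θ) = - g 0 := fun θ => by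
      have h1 : ∀ r : ℝ, ρ < |r| → A (r, θ) = 0 := fun r hr => by
        simp [hA, hz (r * unitVec θ) (by simpa using hr)]
      rw [integral_Ioi_of_hasDerivAt_of_tendsto' (f := fun r : ℝ => g (r * unitVec θ)) (m := 0)
        (fun r _ => hasDerivAt_ray hd r θ)]
      · simp
      · have h2 : IntegrableOn (fun r => A (r, θ)) (Icc 0 ρ) :=
          Continuous.integrableOn_Icc (by fun_prop)
        refine h2.of_forall_sdiff_eq_zero measurableSet_Ioi fun r hr => ?_
        have h3 : 0 < r := hr.1
        refine h1 r ?_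
        by_contra h
        rw [abs_of_pos h3, not_lt] at h
        exact hr.2 ⟨h3.le, h⟩
      · refine tendsto_const_nhds.congr' ?_
        filter_upwards [eventually_gt_atTop (max ρ 0)] with r hr
        by_contra h
        have := hρ (subset_tsupport g (Ne.symm h))
        rw [mem_closedBall_zero_iff, norm_mul, norm_unitVec, mul_one, Complex.norm_real,
          Real.norm_eq_abs, abs_of_pos (lt_of_le_of_lt (le_max_right _ _) hr)] at this
        exact absurd hr (not_lt.2 (this.trans (le_max_left _ _)))
    simp only [Prod.swap_prod_mk, this]
    simp only [integral_const, measureReal_restrict_apply_univ, Real.volume_real_Ioo]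
    rw [max_eq_left (by linarith [pi_pos]), Complex.real_smul]
    push_cast
    ring
  have eB : ∫ p in Ioi (0 : ℝ) ×ˢ Ioo (-π) π, B p = 0 := by
    rw [Measure.volume_eq_prod, setIntegral_prod _ (by exact hBi)]
    refine setIntegral_eq_zero_of_forall_eq_zero fun r hr => ?_
    have hr : (0 : ℝ) < r := hr
    have h1 := integral_circle_fderiv hg r
    rw [intervalIntegral.integral_of_le (by linarith [pi_pos]), integral_Ioc_eq_integral_Ioo] at h1
    have h2 : ∀ θ, fderiv ℝ g (r * unitVec θ) (I * (r * unitVec θ)) = (r : ℝ) • B (r, θ) := by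
      intro θ
      simp only [hB]
      rw [← map_smul, Complex.real_smul, mul_left_comm]
    simp_rw [h2, integral_smul] at h1
    exact (smul_eq_zero.1 h1).resolve_left hr.ne'
  rw [e1, integral_add hAi (hBi.const_mul I), eA, integral_const_mul, eB]
  simp

lemma locallyIntegrable_inv : LocallyIntegrable (fun z : ℂ => z⁻¹) := by
  refine locallyIntegrable_of_norm_le_rpow (C := 1) (α := 1) ?_ ?_ ?_ ?_
  · simp
  · simp
  · exact Eventually.of_forall fun z => by simp [Real.rpow_neg_one]
  · exact measurable_inv.aestronglyMeasurable

lemma integrable_indicator_inv :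
    Integrable ((closedBall (0 : ℂ) 1).indicator fun z : ℂ => z⁻¹) :=
  (locallyIntegrable_inv.integrableOn_isCompact (isCompact_closedBall _ _)).integrable_indicator
    measurableSet_closedBall

lemma norm_indicator_compl_inv_le (z : ℂ) :
    ‖(closedBall (0 : ℂ) 1)ᶜ.indicator (fun z : ℂ => z⁻¹) z‖ ≤ 1 := by
  by_cases h : z ∈ (closedBall (0 : ℂ) 1)ᶜ
  · rw [indicator_of_mem h, norm_inv]
    simp only [mem_compl_iff, mem_closedBall_zero_iff, not_le] at h
    exact inv_le_one_of_one_le₀ h.le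
  · simp [indicator_of_notMem h]

lemma integrable_div_id {h : ℂ → ℂ} (hc : Continuous h) (hi : Integrable h) :
    Integrable fun w => h w / w := by
  have e : (fun w => h w / w) = fun w =>
      (closedBall (0 : ℂ) 1).indicator (fun z : ℂ => h z * z⁻¹) w
      + (closedBall (0 : ℂ) 1)ᶜ.indicator (fun z : ℂ => z⁻¹) w * h w := by
    ext w
    by_cases hw : w ∈ closedBall (0 : ℂ) 1
    · simp [hw, div_eq_mul_inv]
    · simp [hw, div_eq_mul_inv, mul_comm]
  rw [e]
  refine Integrable.add ?_ ?_
  · rw [integrable_indicator_iff measurableSet_closedBall]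
    exact (locallyIntegrable_inv.integrableOn_isCompact
      (isCompact_closedBall _ _)).continuousOn_mul hc.continuousOn (isCompact_closedBall _ _)
  · exact hi.bdd_mul (c := 1)
      (measurable_inv.indicator measurableSet_closedBall.compl).aestronglyMeasurable
      (Eventually.of_forall norm_indicator_compl_inv_le)

/-- Absolute integrability of the Cauchy kernel against a bounded integrable and an integrable
function. -/
lemma integrable_cauchy_kernel {a h : ℂ → ℂ} (ha : Integrable a) (hac : Continuous a) {B : ℝ}
    (hB : ∀ z, ‖a z‖ ≤ B) (hh : Integrable h) :
    Integrable fun p : ℂ × ℂ => a p.1 * h p.2 / (p.1 - p.2) := by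
  have e : (fun p : ℂ × ℂ => a p.1 * h p.2 / (p.1 - p.2)) = fun p : ℂ × ℂ =>
      a p.1 * (h p.2 * (closedBall (0 : ℂ) 1).indicator (fun z : ℂ => z⁻¹) (p.1 - p.2))
      + (closedBall (0 : ℂ) 1)ᶜ.indicator (fun z : ℂ => z⁻¹) (p.1 - p.2) * (a p.1 * h p.2) := by
    ext p
    by_cases hw : p.1 - p.2 ∈ closedBall (0 : ℂ) 1
    · rw [indicator_of_mem hw, indicator_of_notMem (by simpa using hw)]
      ring
    · rw [indicator_of_notMem hw, indicator_of_mem (by simpa using hw)]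
      ring
  rw [e]
  refine Integrable.add ?_ ?_
  · have h1 := hh.convolution_integrand (ContinuousLinearMap.mul ℝ ℂ) integrable_indicator_inv
    exact Integrable.bdd_mul h1 (c := B)
      (hac.comp continuous_fst).aestronglyMeasurable (Eventually.of_forall fun p => hB p.1)
  · refine Integrable.bdd_mul (ha.mul_prod hh) (c := 1) ?_
      (Eventually.of_forall fun p => norm_indicator_compl_inv_le _)
    exact ((measurable_inv.indicator measurableSet_closedBall.compl).comp
      (measurable_fst.sub measurable_snd)).aestronglyMeasurable

/-- Twice the Wirtinger derivative `∂/∂z`. -/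
noncomputable def dz (g : ℂ → ℂ) (z : ℂ) : ℂ := fderiv ℝ g z 1 - I * fderiv ℝ g z I

lemma continuous_dz {g : ℂ → ℂ} (hg : ContDiff ℝ 1 g) : Continuous (dz g) := by
  have := hg.continuous_fderiv one_ne_zero
  unfold dz
  fun_prop

lemma contDiff_dz {g : ℂ → ℂ} {n m : ℕ∞ω} (hg : ContDiff ℝ n g) (hmn : m + 1 ≤ n) :
    ContDiff ℝ m (dz g) := by
  have := hg.fderiv_right hmn
  unfold dz
  fun_prop

lemma contDiff_dbar {g : ℂ → ℂ} {n m : ℕ∞ω} (hg : ContDiff ℝ n g) (hmn : m + 1 ≤ n) :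
    ContDiff ℝ m (dbar g) := by
  have := hg.fderiv_right hmn
  unfold dbar
  fun_prop

lemma dbar_mul {g h : ℂ → ℂ} {z : ℂ} (hg : DifferentiableAt ℝ g z)
    (hh : DifferentiableAt ℝ h z) :
    dbar (fun w => g w * h w) z = g z * dbar h z + h z * dbar g z := by
  simp only [dbar]
  rw [fderiv_fun_mul hg hh]
  simp only [_root_.add_apply, _root_.smul_apply, smul_eq_mul]
  ring

lemma fderiv_comp_smul_real {E : Type*} [NormedAddCommGroup E] [NormedSpace ℝ E] (g : ℂ → E)
    (c : ℝ) (z : ℂ) : fderiv ℝ (fun w => g (c • w)) z = c • fderiv ℝ g (c • z) :=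
  fderiv_comp_smul c

lemma dbar_comp_smul (g : ℂ → ℂ) (c : ℝ) (z : ℂ) :
    dbar (fun w => g (c • w)) z = c * dbar g (c • z) := by
  rw [dbar, dbar, fderiv_comp_smul_real]
  simp only [_root_.smul_apply, Complex.real_smul]
  ring

lemma dz_comp_smul (g : ℂ → ℂ) (c : ℝ) (z : ℂ) :
    dz (fun w => g (c • w)) z = c * dz g (c • z) := by
  rw [dz, dz, fderiv_comp_smul_real]
  simp only [_root_.smul_apply, Complex.real_smul]
  ring

lemma integral_dz_mul {V k : ℂ → ℂ} (hV : ContDiff ℝ 1 V) (hk : ContDiff ℝ 1 k)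
    (hs : HasCompactSupport k) : ∫ w, dz V w * k w = -∫ w, V w * dz k w := by
  have hVc := hV.continuous
  have hkc := hk.continuous
  have hV' := hV.continuous_fderiv one_ne_zero
  have hk' := hk.continuous_fderiv one_ne_zero
  have i1 : ∀ v : ℂ, Integrable fun w => fderiv ℝ V w v * k w := fun v =>
    Continuous.integrable_of_hasCompactSupport (by fun_prop) (hs.mul_left)
  have i2 : ∀ v : ℂ, Integrable fun w => V w * fderiv ℝ k w v := fun v =>
    Continuous.integrable_of_hasCompactSupport (by fun_prop) ((hs.fderiv_apply ℝ v).mul_left)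
  have i3 : Integrable fun w => V w * k w :=
    Continuous.integrable_of_hasCompactSupport (by fun_prop) (hs.mul_left)
  have key : ∀ v : ℂ, ∫ w, fderiv ℝ V w v * k w = -∫ w, V w * fderiv ℝ k w v := fun v => by
    rw [integral_mul_fderiv_eq_neg_fderiv_mul_of_integrable (i1 v) (i2 v) i3
      (fun x _ => hV.differentiable one_ne_zero x) (fun x _ => hk.differentiable one_ne_zero x),
      neg_neg]
  have e1 : ∀ w, dz V w * k w = fderiv ℝ V w 1 * k w - I * (fderiv ℝ V w I * k w) := fun w => by
    simp only [dz]; ring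
  have e2 : ∀ w, V w * dz k w = V w * fderiv ℝ k w 1 - I * (V w * fderiv ℝ k w I) := fun w => by
    simp only [dz]; ring
  simp_rw [e1, e2]
  rw [integral_sub (i1 1) ((i1 I).const_mul I), integral_sub (i2 1) ((i2 I).const_mul I),
    integral_const_mul, integral_const_mul, key, key]
  ring

lemma exists_cutoff : ∃ η : ℂ → ℝ, ContDiff ℝ ∞ η ∧ (∀ z, ‖z‖ ≤ 1 → η z = 1) ∧
    (∀ z, 0 ≤ η z) ∧ (∀ z, η z ≤ 1) ∧ tsupport η = closedBall 0 2 := by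
  let φ : ContDiffBump (0 : ℂ) := ⟨1, 2, one_pos, one_lt_two⟩
  exact ⟨φ, φ.contDiff, fun z hz => φ.one_of_mem_closedBall (by simpa using hz),
    fun z => φ.nonneg, fun z => φ.le_one, φ.tsupport_eq⟩

lemma fderiv_cutoff_eq_zero {η : ℂ → ℝ} (h1 : ∀ z, ‖z‖ ≤ 1 → η z = 1) {z : ℂ} (hz : ‖z‖ < 1) :
    fderiv ℝ η z = 0 := by
  have : η =ᶠ[𝓝 z] fun _ => 1 := by
    filter_upwards [isOpen_ball.mem_nhds (mem_ball_zero_iff.2 hz)] with w hw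
    exact h1 w (mem_ball_zero_iff.1 hw).le
  rw [this.fderiv_eq, fderiv_fun_const]; rfl

lemma fderiv_ofReal_comp {η : ℂ → ℝ} (h : Differentiable ℝ η) (z v : ℂ) :
    fderiv ℝ (fun w => (η w : ℂ)) z v = (fderiv ℝ η z v : ℝ) := by
  have := Complex.ofRealCLM.hasFDerivAt.comp z (h z).hasFDerivAt
  rw [HasFDerivAt.fderiv (f := fun w => (η w : ℂ)) this]
  rfl

lemma contDiff_ofReal_comp {η : ℂ → ℝ} {n : ℕ∞ω} (h : ContDiff ℝ n η) :
    ContDiff ℝ n (fun w => (η w : ℂ)) :=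
  Complex.ofRealCLM.contDiff.comp h

/-- Representation of `∂V` through `∂̄∂V` by the Cauchy kernel, at the origin. -/
lemma integral_dbar_dz_div {V : ℂ → ℂ} (hV : ContDiff ℝ 2 V) (hi : Integrable (dbar (dz V)))
    (hgrow : Tendsto (fun R : ℝ => R⁻¹ ^ 3 * ∫ w in closedBall (0 : ℂ) R, ‖V w‖) atTop (𝓝 0)) :
    ∫ w, dbar (dz V) w / w = -(2 * π) * dz V 0 := by
  obtain ⟨η, hη, hη1, hη0, hηle, hηs⟩ := exists_cutoff
  set ηc : ℂ → ℂ := fun w => (η w : ℂ) with hηc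
  have hηcs : ContDiff ℝ ∞ ηc := contDiff_ofReal_comp hη
  have hdη : ∀ z : ℂ, fderiv ℝ η z = 0 → dbar ηc z = 0 := fun z hz => by
    rw [dbar, fderiv_ofReal_comp (hη.differentiable (by simp)),
      fderiv_ofReal_comp (hη.differentiable (by simp)), hz]
    simp
  set κ : ℂ → ℂ := fun z => dbar ηc z / z with hκ
  have hdbs : ContDiff ℝ 1 (dbar ηc) := contDiff_dbar (n := 2)
    (hηcs.of_le (by exact WithTop.coe_le_coe.2 le_top)) (by norm_num)
  have hκs : ContDiff ℝ 1 κ := by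
    rw [contDiff_iff_contDiffAt]
    intro z
    by_cases hz : z = 0
    · have : κ =ᶠ[𝓝 z] fun _ => 0 := by
        filter_upwards [isOpen_ball.mem_nhds (show z ∈ ball (0 : ℂ) 1 by simp [hz])] with w hw
        simp [hκ, hdη w (fderiv_cutoff_eq_zero hη1 (mem_ball_zero_iff.1 hw))]
      exact contDiffAt_const.congr_of_eventuallyEq this
    · simp only [hκ, div_eq_mul_inv]
      exact hdbs.contDiffAt.mul (contDiffAt_inv ℝ hz)
  have hκ0 : ∀ z, z ∉ closedBall (0 : ℂ) 2 → κ z = 0 := fun z hz => by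
    have : fderiv ℝ η z = 0 := by
      by_contra h
      exact hz (hηs ▸ support_fderiv_subset ℝ (f := η) h)
    simp [hκ, hdη z this]
  have hκcs : HasCompactSupport κ := HasCompactSupport.intro (isCompact_closedBall 0 2) hκ0
  have hdκ : Continuous (dz κ) := continuous_dz hκs
  have hdκ0 : ∀ z, z ∉ closedBall (0 : ℂ) 2 → dz κ z = 0 := fun z hz => by
    have : fderiv ℝ κ z = 0 := by
      by_contra h
      refine hz (closure_minimal ?_ isClosed_closedBall (support_fderiv_subset ℝ (f := κ) h))
      exact fun w hw => by_contra fun h' => hw (hκ0 w h')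
    simp [dz, this]
  obtain ⟨B, hB⟩ := (HasCompactSupport.intro (isCompact_closedBall 0 2)
    hdκ0).exists_bound_of_continuous hdκ
  have hB0 : 0 ≤ B := (norm_nonneg _).trans (hB 0)
  have hP : ContDiff ℝ 1 (dz V) := contDiff_dz hV (by norm_num)
  have hPd := hP.differentiable one_ne_zero
  have hPc := hP.continuous
  have hVc := hV.continuous
  have hdiv : Integrable fun w => dbar (dz V) w / w := integrable_div_id (continuous_dbar hP) hi
  have hηd : Differentiable ℝ ηc := hηcs.differentiable (by simp)
  have hηcont := hηcs.continuous
  -- the truncated identity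
  have key : ∀ R : ℝ, 0 < R → -(2 * π) * dz V 0 =
      (∫ w, ηc (R⁻¹ • w) * (dbar (dz V) w / w)) -
        (R⁻¹ : ℝ) ^ 3 * ∫ w, V w * dz κ (R⁻¹ • w) := by
    intro R hR
    set c : ℝ := R⁻¹ with hc
    have hc0 : 0 < c := inv_pos.2 hR
    have hc0' : (c : ℂ) ≠ 0 := by exact_mod_cast hc0.ne'
    have hsm : ContDiff ℝ ∞ fun w : ℂ => c • w := contDiff_const_smul c
    have hcs : ∀ {k : ℂ → ℂ}, HasCompactSupport k → HasCompactSupport fun w => k (c • w) :=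
      fun hk => hk.comp_smul hc0.ne'
    have h0 := integral_dbar_div (g := fun w => ηc (c • w) * dz V w)
      (((hηcs.comp hsm).of_le (by exact_mod_cast le_top)).mul hP)
      (HasCompactSupport.mul_right (hcs (HasCompactSupport.intro (isCompact_closedBall 0 2)
        fun w hw => by simp [hηc, image_eq_zero_of_notMem_tsupport (hηs ▸ hw)])))
    have h1 : ∀ w, dbar (fun w => ηc (c • w) * dz V w) w / w =
        ηc (c • w) * (dbar (dz V) w / w) + c ^ 2 * (dz V w * κ (c • w)) := fun w => by
      rw [dbar_mul (g := fun w => ηc (c • w))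
        ((hηd _).comp w (hsm.differentiable (by simp) w)) (hPd w), dbar_comp_smul]
      by_cases hw : w = 0
      · simp [hw, hκ]
      · simp only [hκ, Complex.real_smul]
        field_simp
    simp_rw [h1] at h0
    have hκcs' : HasCompactSupport fun w => κ (c • w) := hcs hκcs
    have hκ' : ContDiff ℝ 1 fun w => κ (c • w) :=
      hκs.comp (hsm.of_le (by exact_mod_cast le_top))
    rw [integral_add, integral_const_mul, integral_dz_mul (hV.of_le (by norm_num)) hκ' hκcs'] at h0
    · have h2 : ηc (c • 0) = 1 := by simp [hηc, hη1 0 (by simp)]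
      rw [h2, one_mul] at h0
      rw [← h0]
      simp_rw [dz_comp_smul]
      have h3 : ∀ w, V w * (c * dz κ (c • w)) = c * (V w * dz κ (c • w)) := fun w => by ring
      simp_rw [h3]
      rw [integral_const_mul]
      ring
    · refine hdiv.bdd_mul (c := 1) (Continuous.aestronglyMeasurable (by fun_prop))
        (Eventually.of_forall fun w => ?_)
      simp only [hηc, Complex.norm_real, Real.norm_eq_abs]
      rw [abs_of_nonneg (hη0 _)]
      exact hηle _
    · refine Integrable.const_mul ?_ _
      exact Continuous.integrable_of_hasCompactSupport (hPc.mul hκ'.continuous) hκcs'.mul_left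
  have lim1 : Tendsto (fun R : ℝ => ∫ w, ηc (R⁻¹ • w) * (dbar (dz V) w / w)) atTop
      (𝓝 (∫ w, dbar (dz V) w / w)) := by
    refine tendsto_integral_filter_of_dominated_convergence (fun w => ‖dbar (dz V) w / w‖)
      (Eventually.of_forall fun R => ?_) (Eventually.of_forall fun R => Eventually.of_forall
        fun w => ?_) hdiv.norm (Eventually.of_forall fun w => ?_)
    · exact (Continuous.aestronglyMeasurable (by fun_prop)).mul hdiv.1
    · rw [norm_mul]
      refine mul_le_of_le_one_left (norm_nonneg _) ?_
      simp only [hηc, Complex.norm_real, Real.norm_eq_abs]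
      rw [abs_of_nonneg (hη0 _)]
      exact hηle _
    · refine tendsto_const_nhds.congr' ?_
      filter_upwards [eventually_gt_atTop (max 0 ‖w‖)] with R hR
      have hR0 : 0 < R := (le_max_left _ _).trans_lt hR
      have : η (R⁻¹ • w) = 1 := hη1 _ (by
        rw [norm_smul, norm_inv, Real.norm_of_nonneg hR0.le, inv_mul_le_iff₀ hR0]
        linarith [le_max_right 0 ‖w‖])
      simp only [hηc, this]
      simp
  have lim2 : Tendsto (fun R : ℝ => ((R⁻¹ : ℝ) : ℂ) ^ 3 * ∫ w, V w * dz κ (R⁻¹ • w)) atTop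
      (𝓝 0) := by
    have h2 := (hgrow.comp (tendsto_id.const_mul_atTop (show (0 : ℝ) < 2 by norm_num))).const_mul
      (8 * B)
    rw [mul_zero] at h2
    refine squeeze_zero_norm' ?_ h2
    filter_upwards [eventually_gt_atTop 0] with R hR
    have hR' : 0 < R⁻¹ := inv_pos.2 hR
    have hon : IntegrableOn (fun w => ‖V w‖ * B) (closedBall (0 : ℂ) (2 * R)) :=
      (hVc.norm.mul continuous_const).continuousOn.integrableOn_compact (isCompact_closedBall _ _)
    have h3 : ‖∫ w, V w * dz κ (R⁻¹ • w)‖ ≤ B * ∫ w in closedBall (0 : ℂ) (2 * R), ‖V w‖ := by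
      rw [mul_comm B, ← integral_mul_const,
        ← integral_indicator measurableSet_closedBall]
      refine norm_integral_le_of_norm_le (hon.integrable_indicator measurableSet_closedBall)
        (Eventually.of_forall fun w => ?_)
      by_cases hw : w ∈ closedBall (0 : ℂ) (2 * R)
      · rw [indicator_of_mem hw, norm_mul]
        exact mul_le_mul_of_nonneg_left (hB _) (norm_nonneg _)
      · rw [indicator_of_notMem hw, hdκ0, mul_zero, norm_zero]
        simp only [mem_closedBall_zero_iff, not_le] at hw ⊢
        rw [norm_smul, Real.norm_of_nonneg hR'.le, lt_inv_mul_iff₀ hR]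
        linarith
    rw [norm_mul, norm_pow, Complex.norm_real, Real.norm_of_nonneg hR'.le]
    calc R⁻¹ ^ 3 * ‖∫ w, V w * dz κ (R⁻¹ • w)‖
        ≤ R⁻¹ ^ 3 * (B * ∫ w in closedBall (0 : ℂ) (2 * R), ‖V w‖) := by gcongr
      _ = _ := by
        simp only [Function.comp, id]
        rw [mul_inv]
        ring
  have lim3 := lim1.sub lim2
  rw [sub_zero] at lim3
  refine tendsto_nhds_unique lim3 (tendsto_const_nhds.congr' ?_)
  filter_upwards [eventually_gt_atTop 0] with R hR
  rw [key R hR]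

/-- Representation of `∂V` through `∂̄∂V` by the Cauchy kernel. -/
lemma dz_eq_integral {V : ℂ → ℂ} (hV : ContDiff ℝ 2 V) (hi : Integrable (dbar (dz V)))
    (hgrow : Tendsto (fun R : ℝ => R⁻¹ ^ 3 * ∫ w in closedBall (0 : ℂ) R, ‖V w‖) atTop (𝓝 0))
    (z : ℂ) :
    dz V z = (2 * π)⁻¹ * ∫ w, dbar (dz V) w / (z - w) := by
  have e1 : dz (fun w => V (z + w)) = fun w => dz V (z + w) := by
    ext w
    simp only [dz, fderiv_comp_add_left]
  have e2 : dbar (dz fun w => V (z + w)) = fun w => dbar (dz V) (z + w) := by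
    rw [e1]
    ext w
    simp only [dbar]
    rw [fderiv_comp_add_left]
  have hVc := hV.continuous
  have h := integral_dbar_dz_div (V := fun w => V (z + w))
    (hV.comp (contDiff_const.add contDiff_id)) (by rw [e2]; exact hi.comp_add_left z) ?_
  · rw [e2, e1] at h
    simp only [add_zero] at h
    have h1 : ∫ w, dbar (dz V) (z + w) / w = -∫ w, dbar (dz V) w / (z - w) := by
      rw [← integral_neg, ← integral_add_left_eq_self (fun w => -(dbar (dz V) w / (z - w))) z]
      refine integral_congr_ae (Eventually.of_forall fun w => ?_)
      simp only [sub_add_cancel_left, div_neg, neg_neg]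
    rw [h1] at h
    have hpi : (π : ℂ) ≠ 0 := by exact_mod_cast pi_ne_zero
    have h2 : ∫ w, dbar (dz V) w / (z - w) = 2 * π * dz V z := by linear_combination -h
    rw [h2]
    push_cast
    field_simp
  · have h2 := (hgrow.comp (tendsto_id.const_mul_atTop (show (0 : ℝ) < 2 by norm_num))).const_mul 8
    rw [mul_zero] at h2
    refine squeeze_zero_norm' ?_ h2
    filter_upwards [eventually_gt_atTop 0, eventually_ge_atTop ‖z‖] with R hR hz
    have hR' : 0 < R⁻¹ := inv_pos.2 hR
    have h3 : ∫ w in closedBall (0 : ℂ) R, ‖V (z + w)‖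
        ≤ ∫ w in closedBall (0 : ℂ) (2 * R), ‖V w‖ := by
      have := (measurePreserving_add_left (volume : Measure ℂ) z).setIntegral_preimage_emb
        (measurableEmbedding_addLeft z) (fun w => ‖V w‖) (closedBall z R)
      rw [preimage_add_closedBall, sub_self] at this
      rw [this]
      refine setIntegral_mono_set (hVc.norm.continuousOn.integrableOn_compact
        (isCompact_closedBall _ _)) (Eventually.of_forall fun w => norm_nonneg _)
        (LE.le.eventuallyLE ?_)
      exact closedBall_subset_closedBall' (by rw [dist_zero_right]; linarith)
    have h0 : 0 ≤ ∫ w in closedBall (0 : ℂ) R, ‖V (z + w)‖ :=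
      integral_nonneg fun w => norm_nonneg _
    rw [Real.norm_of_nonneg (by positivity)]
    calc R⁻¹ ^ 3 * ∫ w in closedBall (0 : ℂ) R, ‖V (z + w)‖
        ≤ R⁻¹ ^ 3 * ∫ w in closedBall (0 : ℂ) (2 * R), ‖V w‖ := by gcongr
      _ = _ := by
        simp only [Function.comp, id]
        rw [mul_inv]
        ring

/-- The Laplacian of a function on `ℂ`, through iterated Fréchet derivatives. -/
noncomputable def lapC (U : ℂ → ℝ) (z : ℂ) : ℝ :=
  fderiv ℝ (fderiv ℝ U) z 1 1 + fderiv ℝ (fderiv ℝ U) z I I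

lemma continuous_lapC {U : ℂ → ℝ} (hU : ContDiff ℝ 2 U) : Continuous (lapC U) := by
  have : Continuous (fderiv ℝ (fderiv ℝ U)) :=
    (hU.fderiv_right (m := 1) (by norm_num)).continuous_fderiv one_ne_zero
  unfold lapC
  fun_prop

lemma lapC_rotate (U : ℂ → ℝ) (z v : ℂ) :
    fderiv ℝ (fderiv ℝ U) z v v + fderiv ℝ (fderiv ℝ U) z (I * v) (I * v) =
      ‖v‖ ^ 2 * lapC U z := by
  have h : ∀ a b : ℂ, fderiv ℝ (fderiv ℝ U) z a b =
      a.re * (b.re * fderiv ℝ (fderiv ℝ U) z 1 1 + b.im * fderiv ℝ (fderiv ℝ U) z 1 I)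
      + a.im * (b.re * fderiv ℝ (fderiv ℝ U) z I 1 + b.im * fderiv ℝ (fderiv ℝ U) z I I) := by
    intro a b
    rw [fderiv_real_apply _ a, _root_.add_apply, _root_.smul_apply,
      _root_.smul_apply, fderiv_real_apply (fderiv ℝ (fderiv ℝ U) z 1) b,
      fderiv_real_apply (fderiv ℝ (fderiv ℝ U) z I) b]
    simp only [smul_eq_mul]
  rw [h v v, h (I * v) (I * v), Complex.sq_norm, Complex.normSq_apply, lapC]
  simp only [Complex.I_mul_re, Complex.I_mul_im]
  ring

lemma fderiv_fderiv_apply_clm {U : ℂ → ℝ} (hU : ContDiff ℝ 2 U) (L : ℂ →L[ℝ] ℂ) (w v : ℂ) :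
    fderiv ℝ (fun z => fderiv ℝ U z (L z)) w v =
      fderiv ℝ (fderiv ℝ U) w v (L w) + fderiv ℝ U w (L v) := by
  have h1 : DifferentiableAt ℝ (fderiv ℝ U) w :=
    (hU.fderiv_right (m := 1) (by norm_num)).differentiable one_ne_zero w
  rw [fderiv_clm_apply h1 L.differentiableAt]
  simp [add_comm]

/-- The flux of the radial derivative over circles. -/
lemma hasDerivAt_flux {U : ℂ → ℝ} (hU : ContDiff ℝ 2 U) {r : ℝ} (hr : 0 < r) :
    HasDerivAt (fun s : ℝ => ∫ θ in (-π)..π, fderiv ℝ U (s * unitVec θ) (s * unitVec θ))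
      (∫ θ in (-π)..π, r • lapC U (r * unitVec θ)) r := by
  have hc := continuous_unitVec
  have hD : ContDiff ℝ 1 (fderiv ℝ U) := hU.fderiv_right (by norm_num)
  have hDc := hD.continuous
  have hDDc : Continuous (fderiv ℝ (fderiv ℝ U)) := hD.continuous_fderiv one_ne_zero
  have hlc := continuous_lapC hU
  have h1 : ContDiff ℝ 1 fun w => fderiv ℝ U w w := hD.clm_apply contDiff_id
  have h2 : ContDiff ℝ 1 fun w => fderiv ℝ U w (I * w) :=
    hD.clm_apply (contDiff_const.mul contDiff_id)
  have key := hasDerivAt_integral_circle h1 r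
  convert key using 1
  have hz := integral_circle_fderiv h2 r
  have e1 : ∀ w v, fderiv ℝ (fun w => fderiv ℝ U w w) w v =
      fderiv ℝ (fderiv ℝ U) w v w + fderiv ℝ U w v := fun w v =>
    fderiv_fderiv_apply_clm hU (ContinuousLinearMap.id ℝ ℂ) w v
  have e2 : ∀ w v, fderiv ℝ (fun w => fderiv ℝ U w (I * w)) w v =
      fderiv ℝ (fderiv ℝ U) w v (I * w) + fderiv ℝ U w (I * v) := fun w v =>
    fderiv_fderiv_apply_clm hU (ContinuousLinearMap.mul ℝ ℂ I) w v
  have e3 : r * ∫ θ in (-π)..π, fderiv ℝ (fun w => fderiv ℝ U w w) (r * unitVec θ) (unitVec θ) =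
      ∫ θ in (-π)..π, fderiv ℝ (fun w => fderiv ℝ U w w) (r * unitVec θ) (r * unitVec θ) := by
    rw [← intervalIntegral.integral_const_mul]
    congr 1
    ext θ
    rw [← Complex.real_smul, map_smul, smul_eq_mul]
  have e4 : ∀ w, fderiv ℝ (fun w => fderiv ℝ U w w) w w +
      fderiv ℝ (fun w => fderiv ℝ U w (I * w)) w (I * w) = ‖w‖ ^ 2 * lapC U w := fun w => by
    rw [e1, e2, ← lapC_rotate, ← mul_assoc, Complex.I_mul_I, neg_one_mul, map_neg]
    ring
  have hc1 : Continuous fun w => fderiv ℝ (fun w => fderiv ℝ U w w) w w := by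
    simp_rw [e1]; fun_prop
  have hc2 : Continuous fun w => fderiv ℝ (fun w => fderiv ℝ U w (I * w)) w (I * w) := by
    simp_rw [e2]; fun_prop
  have hm : Continuous fun θ => (r : ℂ) * unitVec θ := by fun_prop
  have i1 : IntervalIntegrable (fun θ => fderiv ℝ (fun w => fderiv ℝ U w w)
      (r * unitVec θ) (r * unitVec θ)) volume (-π) π := (hc1.comp hm).intervalIntegrable _ _
  have i2 : IntervalIntegrable (fun θ => fderiv ℝ (fun w => fderiv ℝ U w (I * w))
      (r * unitVec θ) (I * (r * unitVec θ))) volume (-π) π := (hc2.comp hm).intervalIntegrable _ _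
  have e5 : r * ∫ θ in (-π)..π, fderiv ℝ (fun w => fderiv ℝ U w w) (r * unitVec θ) (unitVec θ) =
      r * ∫ θ in (-π)..π, r • lapC U (r * unitVec θ) := by
    rw [e3, ← add_zero (∫ θ in (-π)..π, _), ← hz, ← intervalIntegral.integral_add i1 i2,
      ← intervalIntegral.integral_const_mul]
    congr 1
    ext θ
    rw [e4, norm_mul, norm_unitVec, mul_one, Complex.norm_real, Real.norm_eq_abs, sq_abs,
      smul_eq_mul]
    ring
  exact (mul_left_cancel₀ hr.ne' e5).symm

lemma flux_eq {U : ℂ → ℝ} (hU : ContDiff ℝ 2 U) {r : ℝ} (hr : 0 ≤ r) :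
    ∫ θ in (-π)..π, fderiv ℝ U (r * unitVec θ) (r * unitVec θ) =
      ∫ s in (0 : ℝ)..r, ∫ θ in (-π)..π, s • lapC U (s * unitVec θ) := by
  have hc := continuous_unitVec
  have hDc : Continuous (fderiv ℝ U) := hU.continuous_fderiv (by norm_num)
  have hlc := continuous_lapC hU
  rw [intervalIntegral.integral_eq_sub_of_hasDerivAt_of_le hr (f := fun s : ℝ =>
    ∫ θ in (-π)..π, fderiv ℝ U (s * unitVec θ) (s * unitVec θ)) ?_
    (fun s hs => hasDerivAt_flux hU hs.1)]
  · simp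
  · apply Continuous.intervalIntegrable
    apply intervalIntegral.continuous_parametric_intervalIntegral_of_continuous'
    simp only [Function.uncurry_def]
    fun_prop
  · apply Continuous.continuousOn
    apply intervalIntegral.continuous_parametric_intervalIntegral_of_continuous'
    simp only [Function.uncurry_def]
    fun_prop

/-- The derivative of circular means, in terms of the flux. -/
lemma hasDerivAt_circular_integral {U : ℂ → ℝ} (hU : ContDiff ℝ 2 U) {r : ℝ} (hr : 0 < r) :
    HasDerivAt (fun s : ℝ => ∫ θ in (-π)..π, U (s * unitVec θ))
      ((∫ s in (0 : ℝ)..r, ∫ θ in (-π)..π, s • lapC U (s * unitVec θ)) / r) r := by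
  convert hasDerivAt_integral_circle (hU.of_le (by norm_num)) r using 1
  rw [← flux_eq hU hr.le, div_eq_iff hr.ne', ← intervalIntegral.integral_mul_const]
  congr 1
  ext θ
  rw [← Complex.real_smul, map_smul, smul_eq_mul, mul_comm]

/-- If the flux is at least `-L` beyond radius `a`, the circular integrals decay at most
logarithmically. -/
lemma circular_integral_ge {U : ℂ → ℝ} (hU : ContDiff ℝ 2 U) {a L : ℝ} (ha : 0 < a)
    (hL : ∀ r, a ≤ r → -L ≤ ∫ s in (0 : ℝ)..r, ∫ θ in (-π)..π, s • lapC U (s * unitVec θ))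
    {r : ℝ} (hr : a ≤ r) :
    (∫ θ in (-π)..π, U (a * unitVec θ)) + L * Real.log a - L * Real.log r ≤
      ∫ θ in (-π)..π, U (r * unitVec θ) := by
  have hd : ∀ s, 0 < s → HasDerivAt
      (fun s : ℝ => (∫ θ in (-π)..π, U (s * unitVec θ)) + L * Real.log s)
      ((∫ s in (0 : ℝ)..s, ∫ θ in (-π)..π, s • lapC U (s * unitVec θ)) / s + L * s⁻¹) s :=
    fun s hs => (hasDerivAt_circular_integral hU hs).add
      ((Real.hasDerivAt_log hs.ne').const_mul L)
  have hm : MonotoneOn (fun s : ℝ => (∫ θ in (-π)..π, U (s * unitVec θ)) + L * Real.log s)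
      (Ici a) := by
    refine monotoneOn_of_deriv_nonneg (convex_Ici a)
      (fun s hs => (hd s (ha.trans_le hs)).continuousAt.continuousWithinAt) ?_ ?_
    · intro s hs
      rw [interior_Ici] at hs
      exact (hd s (ha.trans hs)).differentiableAt.differentiableWithinAt
    · intro s hs
      rw [interior_Ici] at hs
      have hs0 : 0 < s := ha.trans hs
      rw [(hd s hs0).deriv, div_eq_mul_inv, ← add_mul]
      have := hL s hs.le
      exact mul_nonneg (by linarith) (inv_nonneg.2 hs0.le)
  have := hm self_mem_Ici hr hr
  simp only at this
  linarith

/-- A function bounded above with integrable Laplacian is `o(R³)` in the mean over discs. -/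
lemma tendsto_integral_closedBall {U : ℂ → ℝ} (hU : ContDiff ℝ 2 U) {C : ℝ} (hC : ∀ z, U z ≤ C)
    (hi : Integrable (lapC U)) :
    Tendsto (fun R : ℝ => R⁻¹ ^ 3 * ∫ w in closedBall (0 : ℂ) R, |U w|) atTop (𝓝 0) := by
  have hc := continuous_unitVec
  have hUc := hU.continuous
  have hlc := continuous_lapC hU
  set L : ℝ := ∫ z, |lapC U z| with hLdef
  have hL0 : 0 ≤ L := integral_nonneg fun z => abs_nonneg _
  have hflux : ∀ r, 1 ≤ r →
      -L ≤ ∫ s in (0 : ℝ)..r, ∫ θ in (-π)..π, s • lapC U (s * unitVec θ) := by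
    intro r hr
    have hp := integral_polar (h := fun z => |lapC U z|) hlc.abs.stronglyMeasurable hi.abs
    have h1 : |∫ s in (0 : ℝ)..r, ∫ θ in (-π)..π, s • lapC U (s * unitVec θ)| ≤ L := by
      rw [hLdef, ← hp.2, intervalIntegral.integral_of_le (by linarith)]
      have hn : ∀ s ∈ Ioi (0 : ℝ), 0 ≤ ∫ θ in (-π)..π, s • |lapC U (s * unitVec θ)| := by
        intro s hs
        have hs : 0 < s := hs
        refine intervalIntegral.integral_nonneg (by linarith [pi_pos]) fun θ _ => ?_
        rw [smul_eq_mul]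
        positivity
      refine le_trans ?_ (setIntegral_mono_set hp.1
        ((ae_restrict_iff' measurableSet_Ioi).2 (Eventually.of_forall hn))
        (LE.le.eventuallyLE (Ioc_subset_Ioi_self : Ioc 0 r ⊆ Ioi 0)))
      rw [← Real.norm_eq_abs]
      refine norm_integral_le_of_norm_le (hp.1.mono_set Ioc_subset_Ioi_self)
        ((ae_restrict_iff' measurableSet_Ioc).2 (Eventually.of_forall fun s hs => ?_))
      have hs0 : 0 < s := hs.1
      refine (intervalIntegral.norm_integral_le_integral_norm (by linarith [pi_pos])).trans
        (le_of_eq ?_)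
      simp only [Real.norm_eq_abs, smul_eq_mul, abs_mul, abs_of_pos hs0]
    exact (abs_le.1 h1).1
  have hMc : Continuous fun s : ℝ => ∫ θ in (-π)..π, U (s * unitVec θ) := by
    apply intervalIntegral.continuous_parametric_intervalIntegral_of_continuous'
    simp only [Function.uncurry_def]
    fun_prop
  obtain ⟨b, hb⟩ := (isCompact_Icc (a := (0 : ℝ)) (b := 1)).exists_bound_of_continuousOn
    hMc.continuousOn
  have hM : ∀ R, 1 ≤ R → ∀ s, 0 < s → s ≤ R →
      -(b + L * Real.log R) ≤ ∫ θ in (-π)..π, U (s * unitVec θ) := by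
    intro R hR s hs hsR
    have hlog : 0 ≤ L * Real.log R := mul_nonneg hL0 (Real.log_nonneg hR)
    rcases le_total s 1 with h | h
    · have := (abs_le.1 (hb s ⟨hs.le, h⟩)).1
      linarith
    · have h1 := circular_integral_ge hU one_pos hflux h
      have h2 := (abs_le.1 (hb 1 ⟨zero_le_one, le_rfl⟩)).1
      have h3 : L * Real.log s ≤ L * Real.log R := by gcongr
      simp only [Real.log_one] at h1
      linarith
  have hbound : ∀ R, 1 ≤ R → ∫ w in closedBall (0 : ℂ) R, |U w| ≤
      R ^ 2 * (4 * π * |C| + b + L * Real.log R) := by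
    intro R hR
    have hon : IntegrableOn (fun w => |U w|) (closedBall (0 : ℂ) R) :=
      hUc.abs.continuousOn.integrableOn_compact (isCompact_closedBall _ _)
    rw [← integral_indicator measurableSet_closedBall, ← (integral_polar
      (hUc.abs.stronglyMeasurable.indicator measurableSet_closedBall)
      (hon.integrable_indicator measurableSet_closedBall)).2]
    have hnorm : ∀ s θ : ℝ, 0 < s → ‖(s : ℂ) * unitVec θ‖ = s := fun s θ hs => by
      simp [abs_of_pos hs]
    rw [setIntegral_eq_of_subset_of_forall_sdiff_eq_zero measurableSet_Ioi
      (Ioc_subset_Ioi_self : Ioc 0 R ⊆ Ioi 0)]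
    · refine (le_abs_self _).trans ?_
      rw [← Real.norm_eq_abs]
      refine (norm_setIntegral_le_of_norm_le_const (C := R * (4 * π * |C| + b + L * Real.log R))
        (by simp) fun s hs => ?_).trans (le_of_eq ?_)
      · have hs0 : 0 < s := hs.1
        have h1 : ∫ θ in (-π)..π, s • (closedBall (0 : ℂ) R).indicator (fun w => |U w|)
            (s * unitVec θ) = s * ∫ θ in (-π)..π, |U (s * unitVec θ)| := by
          rw [← intervalIntegral.integral_const_mul]
          congr 1
          ext θ
          rw [indicator_of_mem (by
            rw [mem_closedBall_zero_iff, hnorm s θ hs0]; exact hs.2), smul_eq_mul]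
        have h2 : ∫ θ in (-π)..π, |U (s * unitVec θ)| ≤ 4 * π * |C| + b + L * Real.log R := by
          have h3 : ∫ θ in (-π)..π, |U (s * unitVec θ)| ≤
              ∫ θ in (-π)..π, (2 * |C| - U (s * unitVec θ)) := by
            refine intervalIntegral.integral_mono_on (by linarith [pi_pos])
              (Continuous.intervalIntegrable (by fun_prop) _ _)
              (Continuous.intervalIntegrable (by fun_prop) _ _) fun θ _ => ?_
            have := hC (s * unitVec θ)
            have := le_abs_self C
            have := abs_nonneg C
            exact abs_le.2 ⟨by linarith, by linarith⟩
          rw [intervalIntegral.integral_sub (by simp)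
            (Continuous.intervalIntegrable (by fun_prop) _ _), intervalIntegral.integral_const,
            smul_eq_mul] at h3
          have := hM R hR s hs0 hs.2
          linarith
        have h4 : 0 ≤ ∫ θ in (-π)..π, |U (s * unitVec θ)| :=
          intervalIntegral.integral_nonneg (by linarith [pi_pos]) fun θ _ => abs_nonneg _
        rw [h1, Real.norm_of_nonneg (mul_nonneg hs0.le h4)]
        exact mul_le_mul hs.2 h2 h4 (hs0.le.trans hs.2)
      · rw [Real.volume_real_Ioc_of_le (by linarith)]
        ring
    · intro s hs
      have hs0 : 0 < s := hs.1
      have hsR : R < s := by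
        by_contra h
        exact hs.2 ⟨hs0, not_lt.1 h⟩
      refine (intervalIntegral.integral_congr (g := fun _ => 0) fun θ _ => ?_).trans
        intervalIntegral.integral_zero
      dsimp only
      rw [indicator_of_notMem, smul_zero]
      rw [mem_closedBall_zero_iff, hnorm s θ hs0]
      exact not_le.2 hsR
  have hlim : Tendsto (fun R : ℝ => (4 * π * |C| + b) * R⁻¹ + L * (Real.log R / R)) atTop (𝓝 0) := by
    have h1 := (tendsto_inv_atTop_zero (𝕜 := ℝ)).const_mul (4 * π * |C| + b)
    have h2 := (Real.isLittleO_log_id_atTop.tendsto_div_nhds_zero).const_mul L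
    simpa using h1.add h2
  refine squeeze_zero_norm' ?_ hlim
  filter_upwards [eventually_ge_atTop 1] with R hR
  have hR0 : 0 < R := by linarith
  rw [Real.norm_of_nonneg (mul_nonneg (by positivity) (integral_nonneg fun _ => abs_nonneg _))]
  calc R⁻¹ ^ 3 * ∫ w in closedBall (0 : ℂ) R, |U w|
      ≤ R⁻¹ ^ 3 * (R ^ 2 * (4 * π * |C| + b + L * Real.log R)) := by
        gcongr
        exact hbound R hR
    _ = _ := by
      field_simp

/-- A metric `e^{2U}` with integrable curvature and finite second moment has total curvature at
least `4π`. -/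
lemma four_pi_le_total_curvature {U : ℂ → ℝ} (hU : ContDiff ℝ 2 U) (hi : Integrable (lapC U))
    (hmom : Integrable fun z : ℂ => ‖z‖ ^ 2 * Real.exp (2 * U z)) :
    ∫ z, lapC U z ≤ -(4 * π) := by
  by_contra! hlt
  have hc := continuous_unitVec
  have hUc := hU.continuous
  have hp := integral_polar (continuous_lapC hU).stronglyMeasurable hi
  have hlim := intervalIntegral_tendsto_integral_Ioi 0 hp.1 tendsto_id
  rw [hp.2] at hlim
  obtain ⟨R, hR⟩ := eventually_atTop.1 ((hlim.eventually_const_le hlt).and (eventually_ge_atTop 1))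
  have hR0 : 0 < R := by linarith [(hR R le_rfl).2]
  set c : ℝ := (∫ θ in (-π)..π, U (R * unitVec θ)) + 4 * π * Real.log R with hcdef
  have hM : ∀ r, R ≤ r → c - 4 * π * Real.log r ≤ ∫ θ in (-π)..π, U (r * unitVec θ) :=
    fun r hr => circular_integral_ge hU hR0 (fun r hr => (hR r hr).1) hr
  have hexp : ∀ r, R ≤ r → 2 * π * Real.exp (c / π) * (r ^ 4)⁻¹ ≤
      ∫ θ in (-π)..π, Real.exp (2 * U (r * unitVec θ)) := by
    intro r hr
    have hr0 : 0 < r := hR0.trans_le hr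
    set m := ∫ θ in (-π)..π, U (r * unitVec θ) with hm
    have h1 : ∫ θ in (-π)..π, Real.exp (m / π) * (1 + 2 * U (r * unitVec θ) - m / π) ≤
        ∫ θ in (-π)..π, Real.exp (2 * U (r * unitVec θ)) := by
      refine intervalIntegral.integral_mono_on (by linarith [pi_pos])
        (Continuous.intervalIntegrable (by fun_prop) _ _)
        (Continuous.intervalIntegrable (by fun_prop) _ _) fun θ _ => ?_
      have h2 := Real.add_one_le_exp (2 * U (r * unitVec θ) - m / π)
      calc Real.exp (m / π) * (1 + 2 * U (r * unitVec θ) - m / π)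
          ≤ Real.exp (m / π) * Real.exp (2 * U (r * unitVec θ) - m / π) := by
            gcongr; linarith
        _ = _ := by rw [← Real.exp_add]; congr 1; ring
    have h2 : ∫ θ in (-π)..π, Real.exp (m / π) * (1 + 2 * U (r * unitVec θ) - m / π) =
        2 * π * Real.exp (m / π) := by
      rw [intervalIntegral.integral_const_mul, intervalIntegral.integral_sub
        (Continuous.intervalIntegrable (by fun_prop) _ _) (by simp),
        intervalIntegral.integral_add (by simp) (Continuous.intervalIntegrable (by fun_prop) _ _),
        intervalIntegral.integral_const_mul, ← hm]
      simp only [intervalIntegral.integral_const, smul_eq_mul]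
      field_simp
      ring
    rw [h2] at h1
    refine le_trans ?_ h1
    have h3 : Real.exp (c / π) * (r ^ 4)⁻¹ = Real.exp ((c - 4 * π * Real.log r) / π) := by
      have : (r ^ 4)⁻¹ = Real.exp (-(4 * Real.log r)) := by
        rw [Real.exp_neg, mul_comm, Real.exp_mul, Real.exp_log hr0]
        norm_cast
      rw [this, ← Real.exp_add]
      congr 1
      field_simp
      ring
    rw [mul_assoc, h3]
    gcongr
    exact hM r hr
  have hq := (integral_polar (h := fun z : ℂ => ‖z‖ ^ 2 * Real.exp (2 * U z))
    (Continuous.stronglyMeasurable (by fun_prop)) hmom).1.mono_set (Ioi_subset_Ioi hR0.le)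
  refine not_integrableOn_Ioi_inv (a := R) ?_
  have hk : 0 < 2 * π * Real.exp (c / π) := by positivity
  have h4 : IntegrableOn (fun r : ℝ => (2 * π * Real.exp (c / π)) * r⁻¹) (Ioi R) := by
    refine Integrable.mono' hq (Measurable.aestronglyMeasurable (by fun_prop))
      ((ae_restrict_iff' measurableSet_Ioi).2 (Eventually.of_forall fun r hr => ?_))
    have hr0 : 0 < r := hR0.trans hr
    rw [Real.norm_of_nonneg (by positivity)]
    have h5 : ∫ θ in (-π)..π, r • (‖(r : ℂ) * unitVec θ‖ ^ 2 * Real.exp (2 * U (r * unitVec θ)))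
        = r ^ 3 * ∫ θ in (-π)..π, Real.exp (2 * U (r * unitVec θ)) := by
      rw [← intervalIntegral.integral_const_mul]
      congr 1
      ext θ
      rw [norm_mul, norm_unitVec, mul_one, Complex.norm_real, Real.norm_eq_abs, sq_abs, smul_eq_mul]
      ring
    rw [h5]
    calc 2 * π * Real.exp (c / π) * r⁻¹
        = r ^ 3 * (2 * π * Real.exp (c / π) * (r ^ 4)⁻¹) := by field_simp
      _ ≤ _ := by
        gcongr
        exact hexp r (le_of_lt hr)
  have h6 := h4.const_mul (2 * π * Real.exp (c / π))⁻¹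
  refine h6.congr (Eventually.of_forall fun r => ?_)
  simp only
  rw [inv_mul_cancel_left₀ hk.ne']

lemma dbar_dz_ofReal {U : ℂ → ℝ} (hU : ContDiff ℝ 2 U) (z : ℂ) :
    dbar (dz fun w => (U w : ℂ)) z = lapC U z := by
  have hd := hU.differentiable two_ne_zero
  have hD : ContDiff ℝ 1 (fderiv ℝ U) := hU.fderiv_right (by norm_num)
  have hDd := hD.differentiable one_ne_zero
  have hsymm : fderiv ℝ (fderiv ℝ U) z 1 I = fderiv ℝ (fderiv ℝ U) z I 1 :=
    (hU.contDiffAt (x := z)).isSymmSndFDerivAt (by simp) 1 I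
  have e : dz (fun w => (U w : ℂ)) = fun w => (fderiv ℝ U w 1 : ℂ) - I * (fderiv ℝ U w I : ℂ) := by
    ext w
    rw [dz, fderiv_ofReal_comp hd, fderiv_ofReal_comp hd]
  have hdv : ∀ v : ℂ, Differentiable ℝ fun w => fderiv ℝ U w v := fun v => by fun_prop
  have hdc : ∀ v : ℂ, Differentiable ℝ fun w => (fderiv ℝ U w v : ℂ) := fun v =>
    Complex.ofRealCLM.differentiable.comp (hdv v)
  have e2 : ∀ v v' : ℂ, fderiv ℝ (fun w => fderiv ℝ U w v) z v' =
      fderiv ℝ (fderiv ℝ U) z v' v := fun v v' => by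
    rw [fderiv_clm_apply (hDd z) (differentiableAt_const v)]
    simp
  have e3 : ∀ v : ℂ, fderiv ℝ (dz fun w => (U w : ℂ)) z v =
      (fderiv ℝ (fderiv ℝ U) z v 1 : ℂ) - I * (fderiv ℝ (fderiv ℝ U) z v I : ℂ) := fun v => by
    rw [e, fderiv_fun_sub (hdc 1 z) ((hdc I z).const_mul I), fderiv_const_mul (hdc I z)]
    simp only [_root_.sub_apply, _root_.smul_apply, smul_eq_mul]
    rw [fderiv_ofReal_comp (hdv 1), fderiv_ofReal_comp (hdv I), e2, e2]
  rw [dbar, e3, e3, hsymm, lapC]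
  push_cast
  linear_combination (-(fderiv ℝ (fderiv ℝ U) z I I : ℂ)) * Complex.I_mul_I

lemma re_mul_dz_ofReal {U : ℂ → ℝ} (hU : Differentiable ℝ U) (z : ℂ) :
    (z * dz (fun w => (U w : ℂ)) z).re = fderiv ℝ U z z := by
  rw [dz, fderiv_ofReal_comp hU, fderiv_ofReal_comp hU, fderiv_real_apply (fderiv ℝ U z) z]
  simp

/-- The symmetrized Cauchy kernel identity `∬ z f(z) f(w) / (z - w) = ½ (∫ f)²`, with a cutoff. -/
lemma tendsto_integral_cutoff_cauchy {η : ℂ → ℝ} (hη : ContDiff ℝ ∞ η)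
    (hη1 : ∀ z, ‖z‖ ≤ 1 → η z = 1) (hηs : HasCompactSupport η) {f : ℂ → ℂ} (hf : Continuous f)
    (hi : Integrable f) :
    Tendsto (fun c : ℝ => ∫ z, η (c • z) * z * f z * ∫ w, f w / (z - w)) (𝓝[>] 0)
      (𝓝 ((∫ z, f z) ^ 2 / 2)) := by
  have hηc := hη.continuous
  have hψ : ContDiff ℝ 1 fun z : ℂ => (η z : ℂ) * z :=
    ((contDiff_ofReal_comp hη).of_le (by exact_mod_cast le_top)).mul contDiff_id
  have hηs' : HasCompactSupport fun z : ℂ => (η z : ℂ) := hηs.comp_left Complex.ofReal_zero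
  obtain ⟨M, hM⟩ := hψ.lipschitzWith_of_hasCompactSupport hηs'.mul_right one_ne_zero
  have hlip : ∀ c : ℝ, 0 < c → ∀ z w : ℂ,
      ‖(η (c • z) * z - η (c • w) * w) / (z - w)‖ ≤ M := fun c hc z w => by
    rw [norm_div]
    refine div_le_of_le_mul₀ (norm_nonneg _) M.2 ?_
    have h := hM.norm_sub_le (c • z) (c • w)
    rw [← smul_sub, norm_smul] at h
    have h2 : (η (c • z) : ℂ) * (c • z) - η (c • w) * (c • w) =
        c • (η (c • z) * z - η (c • w) * w) := by
      simp only [Complex.real_smul]; ring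
    have h : ‖(η (c • z) : ℂ) * (c • z) - η (c • w) * (c • w)‖ ≤ M * (‖c‖ * ‖z - w‖) := h
    rw [h2, norm_smul, mul_left_comm] at h
    exact le_of_mul_le_mul_left h (norm_pos_iff.2 hc.ne')
  have hsymm : ∀ c : ℝ, 0 < c → ∫ z, η (c • z) * z * f z * ∫ w, f w / (z - w) =
      (∫ p : ℂ × ℂ, (η (c • p.1) * p.1 - η (c • p.2) * p.2) / (p.1 - p.2) * (f p.1 * f p.2)) / 2 := by
    intro c hc
    have hac : Continuous fun z => η (c • z) * z * f z := by fun_prop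
    have has : HasCompactSupport fun z => η (c • z) * z * f z := by
      have : HasCompactSupport fun z => (η (c • z) : ℂ) := hηs'.comp_smul hc.ne'
      exact this.mul_right.mul_right
    obtain ⟨B, hB⟩ := has.exists_bound_of_continuous hac
    have hF := integrable_cauchy_kernel (hac.integrable_of_hasCompactSupport has) hac hB hi
    have e1 : ∫ z, η (c • z) * z * f z * ∫ w, f w / (z - w) =
        ∫ p : ℂ × ℂ, η (c • p.1) * p.1 * f p.1 * f p.2 / (p.1 - p.2) := by
      rw [Measure.volume_eq_prod, integral_prod _ hF]
      congr 1
      ext z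
      rw [← integral_const_mul]
      simp only [mul_div_assoc]
    have e2 : ∫ p : ℂ × ℂ, η (c • p.2) * p.2 * f p.2 * f p.1 / (p.2 - p.1) =
        ∫ p : ℂ × ℂ, η (c • p.1) * p.1 * f p.1 * f p.2 / (p.1 - p.2) :=
      integral_prod_swap (μ := volume) (ν := volume)
        (fun p : ℂ × ℂ => η (c • p.1) * p.1 * f p.1 * f p.2 / (p.1 - p.2))
    have e3 : ∀ p : ℂ × ℂ, (η (c • p.1) * p.1 - η (c • p.2) * p.2) / (p.1 - p.2) * (f p.1 * f p.2) =
        η (c • p.1) * p.1 * f p.1 * f p.2 / (p.1 - p.2) +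
        η (c • p.2) * p.2 * f p.2 * f p.1 / (p.2 - p.1) := fun p => by
      rw [← neg_sub p.1 p.2, div_neg]
      ring
    have hF2 : Integrable fun p : ℂ × ℂ => η (c • p.2) * p.2 * f p.2 * f p.1 / (p.2 - p.1) :=
      hF.swap
    simp_rw [e3]
    rw [integral_add hF hF2, e2, e1]
    ring
  have hlim : Tendsto (fun c : ℝ => (∫ p : ℂ × ℂ, (η (c • p.1) * p.1 - η (c • p.2) * p.2) /
      (p.1 - p.2) * (f p.1 * f p.2)) / 2) (𝓝[>] 0) (𝓝 ((∫ p : ℂ × ℂ, f p.1 * f p.2) / 2)) := by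
    refine Tendsto.div_const ?_ 2
    refine tendsto_integral_filter_of_dominated_convergence (fun p => M * ‖f p.1 * f p.2‖)
      (Eventually.of_forall fun c => ?_) ?_ ((hi.mul_prod hi).norm.const_mul _) ?_
    · exact Measurable.aestronglyMeasurable (by fun_prop)
    · filter_upwards [self_mem_nhdsWithin] with c hc
      refine Eventually.of_forall fun p => ?_
      rw [norm_mul]
      exact mul_le_mul_of_nonneg_right (hlip c hc _ _) (norm_nonneg _)
    · have hdiag : ∀ᵐ p : ℂ × ℂ, p.1 ≠ p.2 := by
        have : MeasurableSet {p : ℂ × ℂ | p.1 ≠ p.2} :=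
          (isClosed_eq continuous_fst continuous_snd).isOpen_compl.measurableSet
        rw [Measure.volume_eq_prod, Measure.ae_prod_iff_ae_ae this]
        exact Eventually.of_forall fun z => by
          filter_upwards [compl_mem_ae_iff.2 (measure_singleton z)] with w hw
          exact fun h => hw h.symm
      filter_upwards [hdiag] with p hp
      have h1 : ∀ z : ℂ, ∀ᶠ c : ℝ in 𝓝[>] 0, η (c • z) = 1 := fun z => by
        have : Tendsto (fun c : ℝ => c • z) (𝓝[>] 0) (𝓝 0) := by
          have : Continuous fun c : ℝ => c • z := by fun_prop
          simpa using (this.tendsto 0).mono_left nhdsWithin_le_nhds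
        filter_upwards [this (closedBall_mem_nhds 0 one_pos)] with c hc
        exact hη1 _ (by simpa using hc)
      refine tendsto_const_nhds.congr' ?_
      filter_upwards [h1 p.1, h1 p.2] with c h1 h2
      rw [h1, h2, Complex.ofReal_one, one_mul, one_mul, div_self (sub_ne_zero.2 hp), one_mul]
  rw [Measure.volume_eq_prod, integral_prod_mul, ← sq] at hlim
  refine hlim.congr' ?_
  filter_upwards [self_mem_nhdsWithin] with c hc
  rw [hsymm c hc, Measure.volume_eq_prod]

/-- Integration by parts against the Euler vector field. -/
lemma integral_mul_fderiv_radial {k E : ℂ → ℝ} (hk : ContDiff ℝ 1 k) (hs : HasCompactSupport k)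
    (hE : ContDiff ℝ 1 E) :
    ∫ z, k z * fderiv ℝ E z z = -∫ z, (2 * k z + fderiv ℝ k z z) * E z := by
  have hkc := hk.continuous
  have hEc := hE.continuous
  have hk' := hk.continuous_fderiv one_ne_zero
  have hE' := hE.continuous_fderiv one_ne_zero
  have hkd := hk.differentiable one_ne_zero
  have i1 : ∀ (l : ℂ →L[ℝ] ℝ) (v : ℂ), Integrable fun z => (k z * l z) * fderiv ℝ E z v :=
    fun l v => Continuous.integrable_of_hasCompactSupport (by fun_prop) hs.mul_right.mul_right
  have i2 : ∀ (l : ℂ →L[ℝ] ℝ) (v : ℂ),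
      Integrable fun z => (k z * l v + l z * fderiv ℝ k z v) * E z := fun l v => by
    refine Continuous.integrable_of_hasCompactSupport (by fun_prop) (HasCompactSupport.mul_right ?_)
    exact HasCompactSupport.add hs.mul_right (hs.fderiv_apply ℝ v).mul_left
  have i3 : ∀ l : ℂ →L[ℝ] ℝ, Integrable fun z => (k z * l z) * E z := fun l =>
    Continuous.integrable_of_hasCompactSupport (by fun_prop) hs.mul_right.mul_right
  have key : ∀ (l : ℂ →L[ℝ] ℝ) (v : ℂ), ∫ z, (k z * l z) * fderiv ℝ E z v =
      -∫ z, (k z * l v + l z * fderiv ℝ k z v) * E z := fun l v => by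
    have hd : ∀ z, fderiv ℝ (fun z => k z * l z) z v = k z * l v + l z * fderiv ℝ k z v :=
      fun z => by
        rw [fderiv_fun_mul (hkd z) l.differentiableAt]
        simp
    have h := integral_mul_fderiv_eq_neg_fderiv_mul_of_integrable (μ := volume)
      (f := fun z => k z * l z) (g := E) (v := v)
      (by simpa only [hd] using i2 l v) (i1 l v) (i3 l)
      (fun z _ => (hkd z).mul l.differentiableAt) (fun z _ => hE.differentiable one_ne_zero z)
    simpa only [hd] using h
  have e1 : ∀ z, k z * fderiv ℝ E z z = (k z * reCLM z) * fderiv ℝ E z 1 +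
      (k z * imCLM z) * fderiv ℝ E z I := fun z => by
    rw [fderiv_real_apply (fderiv ℝ E z) z]
    simp only [smul_eq_mul, reCLM_apply, imCLM_apply]
    ring
  have e2 : ∀ z, (2 * k z + fderiv ℝ k z z) * E z =
      (k z * reCLM 1 + reCLM z * fderiv ℝ k z 1) * E z +
      (k z * imCLM I + imCLM z * fderiv ℝ k z I) * E z := fun z => by
    rw [fderiv_real_apply (fderiv ℝ k z) z]
    simp only [smul_eq_mul, reCLM_apply, imCLM_apply, Complex.one_re, Complex.I_im]
    ring
  simp_rw [e1, e2]
  rw [integral_add (i1 _ _) (i1 _ _), integral_add (i2 _ _) (i2 _ _), key, key]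
  ring

lemma fderiv_self_of_homogeneous {Q : ℂ → ℝ} (hQ : Differentiable ℝ Q)
    (hhom : ∀ (t : ℝ) z, Q (t • z) = t ^ 2 * Q z) (z : ℂ) : fderiv ℝ Q z z = 2 * Q z := by
  have h1 : HasDerivAt (fun t : ℝ => Q (t • z)) (fderiv ℝ Q z z) 1 := by
    have hm : HasDerivAt (fun t : ℝ => t • z) z 1 := by
      simpa using (hasDerivAt_id (1 : ℝ)).smul_const z
    have hq : HasFDerivAt Q (fderiv ℝ Q z) ((1 : ℝ) • z) := by
      rw [one_smul]; exact (hQ z).hasFDerivAt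
    exact hq.comp_hasDerivAt 1 hm
  have h2 : HasDerivAt (fun t : ℝ => Q (t • z)) (2 * Q z) 1 := by
    simp_rw [hhom]
    simpa using (hasDerivAt_pow 2 (1 : ℝ)).mul_const (Q z)
  exact h1.unique h2

/-- The local side of the Pohozaev identity for the curvature `1 + Q`. -/
lemma tendsto_integral_cutoff_pohozaev {η : ℂ → ℝ} (hη : ContDiff ℝ ∞ η)
    (hη1 : ∀ z, ‖z‖ ≤ 1 → η z = 1) (hη0 : ∀ z, 0 ≤ η z) (hηle : ∀ z, η z ≤ 1)
    (hηs : HasCompactSupport η) {U Q : ℂ → ℝ}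
    (hU : ContDiff ℝ 1 U) (hQ : ContDiff ℝ 1 Q) (hhom : ∀ (t : ℝ) z, Q (t • z) = t ^ 2 * Q z)
    (hE : Integrable fun z => Real.exp (2 * U z))
    (hQE : Integrable fun z => Q z * Real.exp (2 * U z)) :
    Tendsto (fun c : ℝ => ∫ z, η (c • z) * ((1 + Q z) * Real.exp (2 * U z)) * fderiv ℝ U z z)
      (𝓝[>] 0) (𝓝 (-∫ z, (1 + 2 * Q z) * Real.exp (2 * U z))) := by
  have hUc := hU.continuous
  have hQc := hQ.continuous
  have hηc := hη.continuous
  have hη' : Continuous (fderiv ℝ η) := hη.continuous_fderiv (by simp)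
  have hUd := hU.differentiable one_ne_zero
  have hQd := hQ.differentiable one_ne_zero
  have hηd := hη.differentiable (by simp)
  set E : ℂ → ℝ := fun z => Real.exp (2 * U z) with hEdef
  have hEs : ContDiff ℝ 1 E := (contDiff_const.mul hU).exp
  have hEc := hEs.continuous
  have hdE : ∀ z v, fderiv ℝ E z v = 2 * E z * fderiv ℝ U z v := fun z v => by
    rw [hEdef, fderiv_exp ((hUd z).const_mul 2), fderiv_const_mul (hUd z)]
    simp only [_root_.smul_apply, smul_eq_mul]
    ring
  obtain ⟨B, hB⟩ := HasCompactSupport.exists_bound_of_continuous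
    (f := fun z => fderiv ℝ η z z) (by
      refine HasCompactSupport.intro hηs.isCompact fun z hz => ?_
      rw [image_eq_zero_of_notMem_tsupport fun h => hz (tsupport_fderiv_subset ℝ h)]
      rfl) (by fun_prop)
  have hparts : ∀ c : ℝ, 0 < c →
      ∫ z, η (c • z) * ((1 + Q z) * E z) * fderiv ℝ U z z =
      -∫ z, (η (c • z) * (1 + 2 * Q z) +
        (1 + Q z) * fderiv ℝ η (c • z) (c • z) / 2) * E z := by
    intro c hc
    have hsm : ContDiff ℝ ∞ fun w : ℂ => c • w := contDiff_const_smul c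
    have hηs' : ContDiff ℝ 1 fun z => η (c • z) := (hη.comp hsm).of_le (by exact_mod_cast le_top)
    have hk : ContDiff ℝ 1 fun z => η (c • z) * (1 + Q z) := hηs'.mul (contDiff_const.add hQ)
    have hks : HasCompactSupport fun z => η (c • z) * (1 + Q z) :=
      HasCompactSupport.mul_right (hηs.comp_smul hc.ne')
    have h := integral_mul_fderiv_radial hk hks hEs
    have h1 : ∀ z, fderiv ℝ (fun z => η (c • z) * (1 + Q z)) z z =
        2 * (η (c • z) * Q z) + (1 + Q z) * fderiv ℝ η (c • z) (c • z) := fun z => by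
      rw [fderiv_fun_mul (hηs'.differentiable one_ne_zero z) ((hQd z).const_add 1),
        fderiv_const_add, fderiv_comp_smul_real]
      simp only [_root_.add_apply, _root_.smul_apply, smul_eq_mul, map_smul]
      rw [fderiv_self_of_homogeneous hQd hhom]
      ring
    have h2 : ∀ z, η (c • z) * (1 + Q z) * fderiv ℝ E z z =
        2 * (η (c • z) * ((1 + Q z) * E z) * fderiv ℝ U z z) := fun z => by
      rw [hdE]; ring
    have h3 : ∀ z, (2 * (η (c • z) * (1 + Q z)) + fderiv ℝ (fun z => η (c • z) * (1 + Q z)) z z) *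
        E z = 2 * ((η (c • z) * (1 + 2 * Q z) +
          (1 + Q z) * fderiv ℝ η (c • z) (c • z) / 2) * E z) := fun z => by
      rw [h1]; ring
    simp_rw [h2, h3] at h
    rw [integral_const_mul, integral_const_mul] at h
    linarith
  have hlim : Tendsto (fun c : ℝ => -∫ z, (η (c • z) * (1 + 2 * Q z) +
      (1 + Q z) * fderiv ℝ η (c • z) (c • z) / 2) * E z) (𝓝[>] 0)
      (𝓝 (-∫ z, (1 + 2 * Q z) * E z)) := by
    refine Tendsto.neg (tendsto_integral_filter_of_dominated_convergence
      (fun z => (1 + B) * E z + (2 + B) * |Q z * E z|)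
      (Eventually.of_forall fun c => Continuous.aestronglyMeasurable (by fun_prop))
      (Eventually.of_forall fun c => Eventually.of_forall fun z => ?_)
      ((hE.const_mul _).add (hQE.abs.const_mul _)) (Eventually.of_forall fun z => ?_))
    · have hE0 : 0 < E z := Real.exp_pos _
      have hb := hB (c • z)
      rw [Real.norm_eq_abs] at hb
      have hB0 : 0 ≤ B := (abs_nonneg _).trans hb
      have e1 : |η (c • z)| ≤ 1 := by rw [abs_of_nonneg (hη0 _)]; exact hηle _
      have e2 : |1 + 2 * Q z| ≤ 1 + 2 * |Q z| := by
        refine (abs_add_le _ _).trans ?_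
        rw [abs_one, abs_mul, abs_two]
      have e3 : |1 + Q z| ≤ 1 + |Q z| := by
        refine (abs_add_le _ _).trans ?_
        rw [abs_one]
      rw [Real.norm_eq_abs, abs_mul, abs_mul, abs_of_pos hE0]
      have e4 : |η (c • z) * (1 + 2 * Q z)| ≤ 1 * (1 + 2 * |Q z|) := by
        rw [abs_mul]
        exact mul_le_mul e1 e2 (abs_nonneg _) zero_le_one
      have e5 : |(1 + Q z) * fderiv ℝ η (c • z) (c • z) / 2| ≤ (1 + |Q z|) * B := by
        rw [abs_div, abs_mul, abs_two]
        refine (half_le_self (by positivity)).trans ?_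
        exact mul_le_mul e3 hb (abs_nonneg _) (by positivity)
      calc _ ≤ (1 * (1 + 2 * |Q z|) + (1 + |Q z|) * B) * E z := by
            gcongr
            exact (abs_add_le _ _).trans (add_le_add e4 e5)
        _ = _ := by ring
    · refine tendsto_const_nhds.congr' ?_
      have : Tendsto (fun c : ℝ => c • z) (𝓝[>] 0) (𝓝 0) := by
        have : Continuous fun c : ℝ => c • z := by fun_prop
        simpa using (this.tendsto 0).mono_left nhdsWithin_le_nhds
      filter_upwards [this (ball_mem_nhds 0 one_pos)] with c hc
      have hc : ‖c • z‖ < 1 := by simpa only [mem_preimage, mem_ball_zero_iff] using hc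
      rw [hη1 _ hc.le, fderiv_cutoff_eq_zero hη1 hc]
      simp
  refine hlim.congr' ?_
  filter_upwards [self_mem_nhdsWithin] with c hc
  rw [hparts c hc]

/-- A negative quadratic form dominates a multiple of the squared norm. -/
lemma exists_sq_norm_le_of_homogeneous {Q : ℂ → ℝ} (hQ : Continuous Q)
    (hhom : ∀ (t : ℝ) z, Q (t • z) = t ^ 2 * Q z) (hneg : ∀ z, z ≠ 0 → Q z < 0) :
    ∃ M, ∀ z, ‖z‖ ^ 2 ≤ M * |Q z| := by
  obtain ⟨z₀, hz₀, hmax⟩ := (isCompact_sphere (0 : ℂ) 1).exists_isMaxOn ⟨1, by simp⟩ hQ.continuousOn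
  have h0 : Q z₀ < 0 := hneg z₀ (by rintro rfl; simp at hz₀)
  refine ⟨(-Q z₀)⁻¹, fun z => ?_⟩
  rw [← div_eq_inv_mul, le_div_iff₀ (neg_pos.2 h0)]
  by_cases hz : z = 0
  · simp only [hz, norm_zero]
    simp
  · have hn : 0 < ‖z‖ := norm_pos_iff.2 hz
    have h1 : Q (‖z‖⁻¹ • z) ≤ Q z₀ := hmax (by simp [hn.ne'])
    rw [hhom, inv_pow, inv_mul_le_iff₀ (by positivity)] at h1
    rw [abs_of_neg (hneg z hz)]
    linarith

/-- There is no metric `e^{2U}` of curvature `1 + Q`, with `Q` a negative quadratic form, finite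
area and finite total absolute curvature, and `U` bounded above. -/
lemma false_of_curvature_eq_one_add {U Q : ℂ → ℝ} {C : ℝ} (hU : ContDiff ℝ 2 U)
    (hC : ∀ z, U z ≤ C) (hQ : ContDiff ℝ 1 Q) (hhom : ∀ (t : ℝ) z, Q (t • z) = t ^ 2 * Q z)
    (hneg : ∀ z, z ≠ 0 → Q z < 0)
    (heq : ∀ z, -lapC U z = (1 + Q z) * Real.exp (2 * U z))
    (hE : Integrable fun z => Real.exp (2 * U z))
    (hKE : Integrable fun z => |1 + Q z| * Real.exp (2 * U z)) : False := by
  have hUc := hU.continuous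
  have hQc := hQ.continuous
  have hlap : lapC U = fun z => -((1 + Q z) * Real.exp (2 * U z)) := by
    ext z; rw [← heq, neg_neg]
  have hi : Integrable (lapC U) := by
    refine hKE.mono' (continuous_lapC hU).aestronglyMeasurable (Eventually.of_forall fun z => ?_)
    rw [hlap, norm_neg, norm_mul, Real.norm_eq_abs, Real.norm_eq_abs, abs_of_pos (Real.exp_pos _)]
  have hQE : Integrable fun z => Q z * Real.exp (2 * U z) := by
    refine (hi.neg.sub hE).congr (Eventually.of_forall fun z => ?_)
    simp only [hlap, Pi.sub_apply, Pi.neg_apply]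
    ring
  obtain ⟨M, hM⟩ := exists_sq_norm_le_of_homogeneous hQc hhom hneg
  have hmom : Integrable fun z : ℂ => ‖z‖ ^ 2 * Real.exp (2 * U z) := by
    refine (hQE.abs.const_mul M).mono' (Continuous.aestronglyMeasurable (by fun_prop))
      (Eventually.of_forall fun z => ?_)
    rw [Real.norm_of_nonneg (by positivity), abs_mul, abs_of_pos (Real.exp_pos _), ← mul_assoc]
    exact mul_le_mul_of_nonneg_right (hM z) (Real.exp_pos _).le
  have htot := four_pi_le_total_curvature hU hi hmom
  obtain ⟨η, hη, hη1, hη0, hηle, hηsupp⟩ := exists_cutoff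
  have hηs : HasCompactSupport η := by
    rw [HasCompactSupport, hηsupp]; exact isCompact_closedBall _ _
  have hloc := tendsto_integral_cutoff_pohozaev hη hη1 hη0 hηle hηs (hU.of_le (by norm_num)) hQ hhom
    hE hQE
  have hiC : Integrable fun z => (lapC U z : ℂ) := hi.ofReal
  have hlc := continuous_lapC hU
  have hglob := tendsto_integral_cutoff_cauchy hη hη1 hηs (f := fun z => (lapC U z : ℂ))
    (by fun_prop) hiC
  rw [integral_complex_ofReal] at hglob
  have hdb : dbar (dz fun w => (U w : ℂ)) = fun z => (lapC U z : ℂ) := funext (dbar_dz_ofReal hU)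
  have hrep : ∀ z, (2 * π) * dz (fun w => (U w : ℂ)) z = ∫ w, (lapC U w : ℂ) / (z - w) := fun z => by
    have h := dz_eq_integral (contDiff_ofReal_comp hU) (by rw [hdb]; exact hiC)
      (by simpa using tendsto_integral_closedBall hU hC hi) z
    rw [hdb] at h
    rw [h, ← mul_assoc]
    have : (2 * π : ℂ) ≠ 0 := by simp [pi_ne_zero]
    push_cast
    rw [mul_inv_cancel₀ this, one_mul]
  have hpoint : ∀ c : ℝ, ∀ z, (η (c • z) * z * (lapC U z : ℂ) * ∫ w, (lapC U w : ℂ) / (z - w)).re =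
      -(2 * π) * (η (c • z) * ((1 + Q z) * Real.exp (2 * U z)) * fderiv ℝ U z z) := fun c z => by
    rw [← hrep, ← heq, ← re_mul_dz_ofReal (hU.differentiable two_ne_zero),
      show (η (c • z) * z * (lapC U z : ℂ) * ((2 * π) * dz (fun w => (U w : ℂ)) z)) =
        ((η (c • z) * lapC U z * (2 * π) : ℝ) : ℂ) * (z * dz (fun w => (U w : ℂ)) z) by
        push_cast; ring, Complex.re_ofReal_mul]
    ring
  have hre := (Complex.continuous_re.tendsto _).comp hglob
  have hcomp : (fun c : ℝ => (∫ z, η (c • z) * z * (lapC U z : ℂ) *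
      ∫ w, (lapC U w : ℂ) / (z - w)).re) =ᶠ[𝓝[>] 0] fun c => -(2 * π) *
      ∫ z, η (c • z) * ((1 + Q z) * Real.exp (2 * U z)) * fderiv ℝ U z z := by
    filter_upwards [self_mem_nhdsWithin] with c hc
    have hP : Continuous (dz fun w => (U w : ℂ)) :=
      continuous_dz ((contDiff_ofReal_comp hU).of_le (by norm_num))
    have hηc := hη.continuous
    rw [← integral_const_mul, ← RCLike.re_eq_complex_re, ← integral_re]
    · simp only [RCLike.re_eq_complex_re, hpoint]
    · simp_rw [← hrep]
      refine Continuous.integrable_of_hasCompactSupport (by fun_prop) ?_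
      have : HasCompactSupport fun z => (η (c • z) : ℂ) :=
        (hηs.comp_left (g := fun x : ℝ => (x : ℂ)) Complex.ofReal_zero).comp_smul hc.ne'
      exact this.mul_right.mul_right.mul_right
  have hfin := tendsto_nhds_unique (hre.congr' hcomp) (hloc.const_mul _)
  have hsplit : ∫ z, (1 + 2 * Q z) * Real.exp (2 * U z) =
      -(∫ z, lapC U z) + ∫ z, Q z * Real.exp (2 * U z) := by
    have hin : Integrable fun z => -lapC U z := hi.neg
    rw [← integral_neg, ← integral_add hin hQE]
    congr 1
    ext z
    rw [heq]
    ring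
  have hQlt : 0 < ∫ z, -(Q z * Real.exp (2 * U z)) := by
    refine integral_pos_of_integrable_nonneg_nonzero (x := 1) (by fun_prop) hQE.neg (fun z => ?_)
      (neg_ne_zero.2 (mul_ne_zero (hneg 1 one_ne_zero).ne (Real.exp_pos _).ne'))
    have hz : Q z ≤ 0 := by
      rcases eq_or_ne z 0 with rfl | hz
      · have : Q 0 = 0 := by simpa using hhom 0 0
        exact this.le
      · exact (hneg z hz).le
    exact neg_nonneg.2 (mul_nonpos_of_nonpos_of_nonneg hz (Real.exp_pos _).le)
  rw [integral_neg] at hQlt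
  rw [hsplit, ← Complex.ofReal_pow, ← Complex.ofReal_ofNat, ← Complex.ofReal_div,
    Complex.ofReal_re] at hfin
  nlinarith [pi_pos, mul_pos pi_pos hQlt]

lemma lapC_comp_repr {u : EuclideanSpace ℝ (Fin 2) → ℝ} (hu : ContDiff ℝ 2 u) (z : ℂ) :
    lapC (u ∘ Complex.orthonormalBasisOneI.repr) z = lap u (Complex.orthonormalBasisOneI.repr z) := by
  have h : ∀ i : Fin 2,
      fderiv ℝ (fderiv ℝ (u ∘ Complex.orthonormalBasisOneI.repr)) z
        (Complex.orthonormalBasisOneI i) (Complex.orthonormalBasisOneI i) =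
      iteratedFDeriv ℝ 2 u (Complex.orthonormalBasisOneI.repr z)
        (fun _ => EuclideanSpace.single i 1) := fun i => by
    have h1 := ContinuousLinearMap.iteratedFDeriv_comp_right
      (Complex.orthonormalBasisOneI.repr.toContinuousLinearEquiv : ℂ →L[ℝ] _) hu z (i := 2) le_rfl
    have h2 := congrArg (fun T => T fun _ => Complex.orthonormalBasisOneI i) h1
    simpa [iteratedFDeriv_two_apply, -Complex.coe_orthonormalBasisOneI] using h2
  rw [lap, Fin.sum_univ_two, ← h, ← h]
  simp [lapC]

end

/-- **Struwe's theorem (JEMS 2020).** If `A` is a negative definite symmetric `2×2` real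
matrix, then there is no smooth solution `u` of `-Δu = (1 + (Ax,x)) e^{2u}` on `ℝ²` which is
bounded above and such that `∫ e^{2u} < ∞` and `∫ |1 + (Ax,x)| e^{2u} < ∞`. -/
theorem no_solution_negdef_quadratic (A : Matrix (Fin 2) (Fin 2) ℝ)
    (hsymm : A.IsSymm)
    (hneg : ∀ x : Fin 2 → ℝ, x ≠ 0 → A.mulVec x ⬝ᵥ x < 0) :
    ¬ ∃ (u : EuclideanSpace ℝ (Fin 2) → ℝ) (C : ℝ),
      ContDiff ℝ (⊤ : ℕ∞) u ∧
      (∀ x, u x ≤ C) ∧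
      (∀ x : EuclideanSpace ℝ (Fin 2),
        -lap u x = (1 + A.mulVec (fun i => x i) ⬝ᵥ (fun i => x i)) * Real.exp (2 * u x)) ∧
      Integrable (fun x : EuclideanSpace ℝ (Fin 2) => Real.exp (2 * u x)) ∧
      Integrable (fun x : EuclideanSpace ℝ (Fin 2) =>
        |1 + A.mulVec (fun i => x i) ⬝ᵥ (fun i => x i)| * Real.exp (2 * u x)) := by
  rintro ⟨u, C, hu, hC, heq, hE, hKE⟩
  set e := Complex.orthonormalBasisOneI.repr
  have hmp : MeasurePreserving e := e.measurePreserving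
  have hme : MeasurableEmbedding e := e.toHomeomorph.measurableEmbedding
  have hu2 : ContDiff ℝ 2 u := hu.of_le (by exact WithTop.coe_le_coe.2 le_top)
  refine false_of_curvature_eq_one_add (U := u ∘ e)
    (Q := fun z => A.mulVec (fun i => e z i) ⬝ᵥ (fun i => e z i)) (C := C)
    (hu2.comp e.contDiff) (fun z => hC _) ?_ (fun t z => ?_) (fun z hz => hneg _ fun h => ?_)
    (fun z => ?_) ((hmp.integrable_comp_emb hme).2 hE) ((hmp.integrable_comp_emb hme).2 hKE)
  · have hc : ∀ i, ContDiff ℝ 1 fun z => e z i := fun i =>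
      contDiff_euclidean.1 e.contDiff i
    simp only [dotProduct, Matrix.mulVec, Fin.sum_univ_two]
    have h0 := hc 0
    have h1 := hc 1
    fun_prop
  · simp only [map_smul, dotProduct, Matrix.mulVec, Fin.sum_univ_two, PiLp.smul_apply, smul_eq_mul]
    ring
  · refine hz (e.map_eq_zero_iff.1 ?_)
    ext i
    exact congrFun h i
  · rw [lapC_comp_repr hu2]
    exact heq (e z)
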